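/- arXiv:2112.14365 — 4 statements merged into one kernel-verified Lean document; each statement's English description precedes it below -/
import Mathlib

section
/- Let b ≥ 2 be an integer base. (i) Every integer u > b has a unique representation u = c·(b^m + 1) + k, where m ≥ 1, 1 ≤ c ≤ b−1, and 0 ≤ k ≤ b^m if c < b−1 while 0 ≤ k ≤ b^m − b + 1 if c = b−1; explicitly, m = ⌊log_b(u−1)⌋, c = ⌊u/(b^m+1)⌋, and k = u − c·(b^m+1). (ii) If u ≤ u′ are integers greater than b with representations (m, c, k) and (m′, c′, k′) respectively, then the triple (m, c, k) is lexicographically at most (m′, c′, k′): m ≤ m′; if m = m′ then c ≤ c′; and if m = m′ and c = c′ then k ≤ k′. -/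
namespace Kaprekar

/-- The exponent `m` in the canonical representation `u = c(b^m+1)+k`. -/
def repM (b u : ℕ) : ℕ := Nat.log b (u - 1)

/-- The coefficient `c` in the canonical representation `u = c(b^m+1)+k`. -/
def repC (b u : ℕ) : ℕ := u / (b ^ repM b u + 1)

/-- The remainder `k` in the canonical representation `u = c(b^m+1)+k`. -/
def repK (b u : ℕ) : ℕ := u - repC b u * (b ^ repM b u + 1)

/-- The exponent is determined by `b ^ m < u ≤ b ^ (m + 1)`. -/
theorem repM_eq {b u m : ℕ} (h₁ : b ^ m < u) (h₂ : u ≤ b ^ (m + 1)) :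
    repM b u = m :=
  Nat.log_eq_of_pow_le_of_lt_pow (by omega) (by omega)

theorem pow_repM_lt {b u : ℕ} (hu : 1 < u) : b ^ repM b u < u := by
  have := Nat.pow_log_le_self b (x := u - 1) (by omega)
  unfold repM
  omega

theorem le_pow_repM_succ {b u : ℕ} (hb : 2 ≤ b) : u ≤ b * b ^ repM b u := by
  have := Nat.lt_pow_succ_log_self hb (u - 1)
  rw [pow_succ'] at this
  unfold repM
  omega

theorem one_le_repM {b u : ℕ} (hb : 2 ≤ b) (hu : b < u) : 1 ≤ repM b u :=
  Nat.log_pos hb (by omega)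

theorem eq_repC_mul_add_repK (b u : ℕ) :
    u = repC b u * (b ^ repM b u + 1) + repK b u :=
  (Nat.add_sub_cancel' (Nat.div_mul_le_self _ _)).symm

theorem repK_le (b u : ℕ) : repK b u ≤ b ^ repM b u := by
  have h := Nat.mod_lt u (Nat.succ_pos (b ^ repM b u))
  have h' := Nat.div_add_mod' u (b ^ repM b u + 1)
  unfold repK repC
  simp only [Nat.succ_eq_add_one] at h
  omega

theorem repC_le {b u : ℕ} (hb : 2 ≤ b) : repC b u ≤ b - 1 := by
  refine Nat.le_sub_one_of_lt (Nat.div_lt_of_lt_mul ?_)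
  nlinarith [le_pow_repM_succ (u := u) hb]

theorem one_le_repC {b u : ℕ} (hu : 1 < u) : 1 ≤ repC b u :=
  Nat.div_pos (pow_repM_lt hu) (Nat.succ_pos _)

theorem repK_le_of_repC_eq {b u : ℕ} (hb : 2 ≤ b) (hu : b < u) (hc : repC b u = b - 1) :
    repK b u ≤ b ^ repM b u - b + 1 := by
  have hP : b ≤ b ^ repM b u := Nat.le_self_pow (Nat.one_le_iff_ne_zero.mp (one_le_repM hb hu)) b
  have h := eq_repC_mul_add_repK b u
  have hle := le_pow_repM_succ (u := u) hb
  rw [hc] at h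
  generalize b ^ repM b u = P at *
  zify [hP, (by omega : 1 ≤ b)] at *
  nlinarith

theorem rep_unique {b u m c k : ℕ} (hm : 1 ≤ m) (hc : 1 ≤ c) (hcb : c ≤ b - 1)
    (hk : c < b - 1 → k ≤ b ^ m) (hk' : c = b - 1 → k ≤ b ^ m - b + 1)
    (hu : u = c * (b ^ m + 1) + k) :
    m = repM b u ∧ c = repC b u ∧ k = repK b u := by
  have hP : b ≤ b ^ m := Nat.le_self_pow (by omega) b
  have hkP : k ≤ b ^ m := by omega
  have hlt : b ^ m < u := by nlinarith
  have hle : u ≤ b ^ (m + 1) := by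
    rw [pow_succ', hu]
    obtain ⟨d, rfl⟩ : ∃ d, b = d + 1 := ⟨b - 1, by omega⟩
    simp only [Nat.add_sub_cancel] at *
    generalize (d + 1) ^ m = P at *
    rcases hcb.lt_or_eq with h | rfl
    · nlinarith [Nat.mul_le_mul_right (P + 1) (Nat.succ_le_of_lt h)]
    · have := hk' rfl
      have : k + c ≤ P := by omega
      nlinarith
  have hM : repM b u = m := repM_eq hlt hle
  have hC : repC b u = c := by
    rw [repC, hM]
    exact Nat.div_eq_of_lt_le (by omega) (by rw [hu, add_mul]; omega)
  refine ⟨hM.symm, hC.symm, ?_⟩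
  rw [repK, hM, hC]
  omega

theorem stmt5 (b : ℕ) (hb : 2 ≤ b) :
    (∀ u : ℕ, b < u →
      (1 ≤ repM b u ∧ 1 ≤ repC b u ∧ repC b u ≤ b - 1 ∧
        (repC b u < b - 1 → repK b u ≤ b ^ repM b u) ∧
        (repC b u = b - 1 → repK b u ≤ b ^ repM b u - b + 1) ∧
        u = repC b u * (b ^ repM b u + 1) + repK b u) ∧
      (∀ m c k : ℕ, 1 ≤ m → 1 ≤ c → c ≤ b - 1 →
        (c < b - 1 → k ≤ b ^ m) → (c = b - 1 → k ≤ b ^ m - b + 1) →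
        u = c * (b ^ m + 1) + k →
        m = repM b u ∧ c = repC b u ∧ k = repK b u)) ∧
    (∀ u u' : ℕ, b < u → b < u' → u ≤ u' →
      repM b u ≤ repM b u' ∧
      (repM b u = repM b u' → repC b u ≤ repC b u') ∧
      (repM b u = repM b u' ∧ repC b u = repC b u' → repK b u ≤ repK b u')) := by
  refine ⟨fun u hu => ⟨⟨one_le_repM hb hu, one_le_repC (by omega), repC_le hb,
    fun _ => repK_le b u, repK_le_of_repC_eq hb hu, eq_repC_mul_add_repK b u⟩,
    fun m c k => rep_unique⟩, fun u u' _ _ huu' => ⟨?_, fun hm => ?_, fun ⟨hm, hc⟩ => ?_⟩⟩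
  · exact Nat.log_mono_right (Nat.sub_le_sub_right huu' 1)
  · rw [repC, repC, hm]
    exact Nat.div_le_div_right huu'
  · rw [repK, repK, hm, hc]
    exact Nat.sub_le_sub_right huu' _

end Kaprekar
end

section
/- Let b ≥ 2 be an integer base and let u ≥ 2 be an integer. Set m := ⌊log_b(u−1)⌋, c := ⌊u/(b^m+1)⌋, and k := u − c·(b^m+1). Then Gen(u) = { c·b^m + v : v ∈ Gen(k) } ∪ { c·b^m − 1 − v : v ∈ Gen((b−1)·m − k − 2) }, where Gen(t) := ∅ when the integer (b−1)·m − k − 2 is negative. -/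
namespace Kaprekar

/-- Sum of the digits of `v` in base `b`. -/
def s (b v : ℕ) : ℕ := (Nat.digits b v).sum

/-- `f v = v + s v`. -/
def f (b v : ℕ) : ℕ := v + s b v

/-- The set of generators of an integer `t` (empty when `t < 0`). -/
def GenZ (b : ℕ) (t : ℤ) : Set ℕ := {v : ℕ | (f b v : ℤ) = t}

@[simp]
theorem s_zero (b : ℕ) : s b 0 = 0 := by simp [s]

theorem s_mul_add {b d : ℕ} (hb : 2 ≤ b) (x : ℕ) (hd : d < b) :
    s b (b * x + d) = d + s b x := by
  by_cases h : d ≠ 0 ∨ x ≠ 0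
  · rw [add_comm, s, Nat.digits_add b hb d x hd h, List.sum_cons, s]
  · push Not at h
    simp [h.1, h.2]

theorem s_mul_pow_add {b q : ℕ} (hb : 2 ≤ b) (hq : q < b) (m : ℕ) :
    ∀ r < b ^ m, s b (q * b ^ m + r) = q + s b r := by
  induction m with
  | zero =>
    intro r hr
    obtain rfl : r = 0 := by simpa using hr
    simpa using s_mul_add hb 0 hq
  | succ m ih =>
    intro r hr
    have hd : r % b < b := Nat.mod_lt _ (by lia)
    have hx : r / b < b ^ m := Nat.div_lt_of_lt_mul (by rwa [mul_comm, ← pow_succ])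
    have hr' := Nat.div_add_mod r b
    have hsplit : q * b ^ (m + 1) + r = b * (q * b ^ m + r / b) + r % b := by
      nth_rewrite 1 [← hr']
      ring
    rw [hsplit, s_mul_add hb _ hd, ih _ hx]
    nth_rewrite 3 [← hr']
    rw [s_mul_add hb _ hd]
    ring

/-- Complementing all `m` digits of `r` complements the digit sum. -/
theorem s_add_s_of_add_add_one_eq_pow {b : ℕ} (hb : 2 ≤ b) (m : ℕ) :
    ∀ r t, r + t + 1 = b ^ m → s b r + s b t = (b - 1) * m := by
  induction m with
  | zero =>
    intro r t h
    obtain ⟨rfl, rfl⟩ : r = 0 ∧ t = 0 := by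
      rw [pow_zero] at h
      lia
    simp
  | succ m ih =>
    intro r t h
    have hd : r % b < b := Nat.mod_lt _ (by lia)
    have hx : r / b < b ^ m := Nat.div_lt_of_lt_mul (by rw [mul_comm, ← pow_succ]; lia)
    have hr' := Nat.div_add_mod r b
    obtain ⟨y, hy⟩ : ∃ y, r / b + y + 1 = b ^ m := ⟨b ^ m - r / b - 1, by lia⟩
    obtain ⟨e, he⟩ : ∃ e, r % b + e + 1 = b := ⟨b - r % b - 1, by lia⟩
    have ht : t = b * y + e := by
      rw [pow_succ, ← hy] at h
      nlinarith
    have hrs : s b r = r % b + s b (r / b) := by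
      nth_rewrite 1 [← hr']
      exact s_mul_add hb _ hd
    rw [hrs, ht, s_mul_add hb y (by lia), mul_add, ← ih _ _ hy]
    lia

theorem s_le_self (b v : ℕ) : s b v ≤ v := Nat.digit_sum_le b v

theorem s_pos {b v : ℕ} (hv : 0 < v) : 0 < s b v := by
  have hne : Nat.digits b v ≠ [] := Nat.digits_ne_nil_iff_ne_zero.2 hv.ne'
  have hlast := Nat.getLast_digit_ne_zero b hv.ne'
  have hle := List.le_sum_of_mem (List.getLast_mem hne)
  rw [s]
  lia

theorem f_mul_pow_add {b q m r : ℕ} (hb : 2 ≤ b) (hq : q < b) (hr : r < b ^ m) :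
    f b (q * b ^ m + r) = q * (b ^ m + 1) + f b r := by
  rw [f, f, s_mul_pow_add hb hq m r hr]
  ring

theorem f_add_f_of_add_add_one_eq_pow {b m r t : ℕ} (hb : 2 ≤ b) (h : r + t + 1 = b ^ m) :
    f b r + f b t + 1 = b ^ m + (b - 1) * m := by
  have := s_add_s_of_add_add_one_eq_pow hb m r t h
  rw [f, f]
  lia

theorem sub_one_mul_lt_pow {b : ℕ} (hb : 2 ≤ b) (m : ℕ) : (b - 1) * m < b ^ m := by
  obtain ⟨a, rfl⟩ : ∃ a, b = a + 1 := ⟨b - 1, by lia⟩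
  rw [Nat.add_sub_cancel]
  induction m with
  | zero => simp
  | succ m ih =>
    have hpos : 1 ≤ (a + 1) ^ m := Nat.one_le_pow _ _ (by lia)
    rw [pow_succ]
    nlinarith [Nat.mul_le_mul_left a hpos]

theorem stmt6 (b u m c k : ℕ) (hb : 2 ≤ b) (hu : 2 ≤ u)
    (hm : m = Nat.log b (u - 1)) (hc : c = u / (b ^ m + 1))
    (hk : k = u - c * (b ^ m + 1)) :
    GenZ b (u : ℤ) =
      {w : ℕ | ∃ v ∈ GenZ b (k : ℤ), w = c * b ^ m + v} ∪
      {w : ℕ | ∃ v ∈ GenZ b (((b : ℤ) - 1) * m - k - 2),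
        (w : ℤ) = (c : ℤ) * (b : ℤ) ^ m - 1 - v} := by
  have hlow : b ^ m ≤ u - 1 := hm ▸ Nat.pow_log_le_self b (by lia)
  have hupp : u - 1 < b ^ m * b := by
    rw [← pow_succ, hm]
    exact Nat.lt_pow_succ_log_self hb _
  have hcu : c * (b ^ m + 1) ≤ u := hc ▸ Nat.div_mul_le_self _ _
  have huk : u = c * (b ^ m + 1) + k := by lia
  have huc : u < (c + 1) * (b ^ m + 1) := by
    rw [hc, mul_comm]
    exact Nat.lt_mul_div_succ u (by lia)
  have hkb : k ≤ b ^ m := by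
    rw [add_mul] at huc
    lia
  have hc1 : 1 ≤ c := hc ▸ Nat.div_pos (by lia) (by lia)
  have hcb : c < b := by
    by_contra! h
    have := Nat.mul_le_mul_right (b ^ m + 1) h
    rw [mul_add, mul_comm b] at this
    lia
  obtain ⟨d, rfl⟩ : ∃ d, c = d + 1 := ⟨c - 1, by lia⟩
  have hcast : ((b : ℤ) - 1) * m = (((b - 1) * m : ℕ) : ℤ) := by
    push_cast [Nat.cast_sub (show 1 ≤ b by lia)]
    ring
  have hbern := sub_one_mul_lt_pow hb m
  ext w
  simp only [GenZ, Set.mem_union, Set.mem_ofPred_eq, hcast]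
  constructor
  · intro hw
    have hw : f b w = u := by exact_mod_cast hw
    have hwu : w < b ^ m * b := by
      rcases Nat.eq_zero_or_pos w with rfl | hpos
      · exact Nat.zero_lt_of_lt hupp
      · have hs := s_pos (b := b) hpos
        rw [f] at hw
        lia
    have hq : w / b ^ m < b := Nat.div_lt_of_lt_mul hwu
    have hr : w % b ^ m < b ^ m := Nat.mod_lt _ (by positivity)
    have hw' : w = w / b ^ m * b ^ m + w % b ^ m := by rw [mul_comm, Nat.div_add_mod]
    generalize w / b ^ m = q at *
    generalize w % b ^ m = r at *
    subst hw'
    rw [f_mul_pow_add hb hq hr] at hw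
    have hfr : f b r < 2 * b ^ m := by
      have := s_le_self b r
      rw [f]
      lia
    have hqc : q ≤ d + 1 := by
      by_contra! h
      have := Nat.mul_le_mul_right (b ^ m + 1) (show d + 1 + 1 ≤ q from h)
      lia
    have hcq : d ≤ q := by
      by_contra! h
      have := Nat.mul_le_mul_right (b ^ m + 1) (show q + 1 ≤ d from h)
      simp only [add_mul] at *
      lia
    obtain rfl | rfl : q = d + 1 ∨ q = d := by lia
    · exact Or.inl ⟨r, by lia, rfl⟩
    · obtain ⟨t, ht⟩ : ∃ t, r + t + 1 = b ^ m := ⟨b ^ m - r - 1, by lia⟩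
      have hft := f_add_f_of_add_add_one_eq_pow hb ht
      refine Or.inr ⟨t, ?_, ?_⟩
      · simp only [add_mul] at *
        lia
      · have : (r : ℤ) + t + 1 = (b : ℤ) ^ m := by exact_mod_cast ht
        push_cast
        linarith
  · rintro (⟨v, hv, rfl⟩ | ⟨v, hv, hw⟩)
    · have hv : f b v = k := by exact_mod_cast hv
      have hvb : v < b ^ m := by
        by_contra! h
        have hpos : 0 < b ^ m := by positivity
        have hs := s_pos (b := b) (hpos.trans_le h)
        rw [f] at hv
        lia
      rw [f_mul_pow_add hb hcb hvb, hv, huk]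
    · have hvb : v < b ^ m := by
        rw [f] at hv
        lia
      obtain ⟨r, hr⟩ : ∃ r, r + v + 1 = b ^ m := ⟨b ^ m - v - 1, by lia⟩
      have hft := f_add_f_of_add_add_one_eq_pow hb hr
      have hwd : w = d * b ^ m + r := by
        have : (r : ℤ) + v + 1 = (b : ℤ) ^ m := by exact_mod_cast hr
        zify
        rw [hw]
        push_cast
        linarith
      rw [hwd, f_mul_pow_add hb (by lia) (by lia), huk]
      simp only [add_mul] at *
      lia

end Kaprekar
end

section
/- Let b ≥ 2 be an integer base. If b is even, then for each λ with 0 ≤ λ ≤ b−2, the least u ∈ ℕ with F(u) = 2 and u ≡ 2 + 2λ (mod b−1) exists and equals K_{2+2λ}(2) = b² + 1 + 2λ. If b ≥ 3 is odd, then for each λ with 0 ≤ λ ≤ (b−3)/2, the least u ∈ ℕ with F(u) = 2 and u ≡ 2 + 2λ (mod b−1) exists and equals K_{2+2λ}(2) = b + 1 + 2λ. -/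
namespace Kaprekar

/-- `F u` is the number of generators of `u`. -/
noncomputable def F (b u : ℕ) : ℕ := Set.ncard {v : ℕ | f b v = u}

theorem s_add_mul {b c : ℕ} (hb : 2 ≤ b) (hc : c < b) (a : ℕ) :
    s b (c + b * a) = c + s b a := by
  unfold s
  rcases Nat.eq_zero_or_pos (c + b * a) with h | h
  · have hc0 : c = 0 := by omega
    have ha0 : a = 0 := by
      have : b * a = 0 := by omega
      rcases Nat.mul_eq_zero.1 this with h' | h' <;> omega
    simp [hc0, ha0]
  · rw [Nat.digits_def' (by omega) h, Nat.add_mul_mod_self_left, Nat.mod_eq_of_lt hc,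
      Nat.add_mul_div_left _ _ (by omega), Nat.div_eq_of_lt hc]
    simp

theorem s_of_lt {b c : ℕ} (hb : 2 ≤ b) (hc : c < b) : s b c = c := by
  have h := s_add_mul hb hc 0
  simpa [s] using h

theorem f_two_digits {b a c : ℕ} (hb : 2 ≤ b) (ha : a < b) (hc : c < b) :
    f b (c + b * a) = b * a + a + 2 * c := by
  rw [f, s_add_mul hb hc, s_of_lt hb ha]
  ring

theorem f_sq_add {b c : ℕ} (hb : 2 ≤ b) (hc : c < b) : f b (b ^ 2 + c) = b ^ 2 + 1 + 2 * c := by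
  have h : b ^ 2 + c = c + b * (0 + b * 1) := by ring
  rw [f, h, s_add_mul hb hc, s_add_mul hb (by omega), s_of_lt hb (by omega)]
  ring

theorem f_sq_add_add {b c : ℕ} (hb : 2 ≤ b) (hc : c < b) :
    f b (b ^ 2 + b + c) = b ^ 2 + b + 2 + 2 * c := by
  have h : b ^ 2 + b + c = c + b * (1 + b * 1) := by ring
  rw [f, h, s_add_mul hb hc, s_add_mul hb (by omega), s_of_lt hb (by omega)]
  ring

theorem exists_digits_of_lt_sq {b v : ℕ} (hv : v < b ^ 2) :
    ∃ a c, a < b ∧ c < b ∧ v = c + b * a := by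
  have hb : 0 < b := by
    rcases Nat.eq_zero_or_pos b with rfl | h
    · simp at hv
    · exact h
  exact ⟨v / b, v % b, Nat.div_lt_of_lt_mul (by rwa [← sq]), Nat.mod_lt _ hb,
    (Nat.mod_add_div v b).symm⟩

/-- In an even base, `f` is injective on the numbers with at most two digits. -/
theorem f_injOn_of_even {b v w : ℕ} (hb : 2 ≤ b) (he : Even b) (hv : v < b ^ 2) (hw : w < b ^ 2)
    (h : f b v = f b w) : v = w := by
  obtain ⟨a, c, ha, hc, rfl⟩ := exists_digits_of_lt_sq hv
  obtain ⟨a', c', ha', hc', rfl⟩ := exists_digits_of_lt_sq hw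
  rw [f_two_digits hb ha hc, f_two_digits hb ha' hc'] at h
  zify at h
  have hd : ((b : ℤ) + 1) ∣ 2 * ((c' : ℤ) - c) := ⟨(a : ℤ) - a', by linear_combination -h⟩
  have hcop : IsCoprime ((b : ℤ) + 1) 2 := by
    obtain ⟨k, rfl⟩ := he
    exact ⟨1, -k, by push_cast; ring⟩
  have h0 : (c' : ℤ) - c = 0 :=
    Int.eq_zero_of_abs_lt_dvd (hcop.dvd_of_dvd_mul_left hd) (by rw [abs_lt]; omega)
  have hcc : c = c' := by omega
  have haa : ((b : ℤ) + 1) * ((a : ℤ) - a') = 0 := by linear_combination h + 2 * h0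
  have haa' : a = a' := by
    rcases mul_eq_zero.1 haa with h' | h' <;> omega
  rw [hcc, haa']

theorem exists_ne_of_F_eq_two {b u : ℕ} (h : F b u = 2) :
    ∃ v w, v ≠ w ∧ f b v = u ∧ f b w = u := by
  obtain ⟨v, w, hne, hs⟩ := Set.ncard_eq_two.1 h
  have hv : v ∈ {v : ℕ | f b v = u} := by simp [hs]
  have hw : w ∈ {v : ℕ | f b v = u} := by simp [hs]
  exact ⟨v, w, hne, hv, hw⟩

theorem le_f (b v : ℕ) : v ≤ f b v := Nat.le_add_right _ _

theorem F_even {b lam : ℕ} (hb : 2 ≤ b) (he : Even b) (hl : lam ≤ b - 2) :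
    F b (b ^ 2 + 1 + 2 * lam) = 2 := by
  obtain ⟨m, rfl⟩ : ∃ m, b = m + 1 := ⟨b - 1, by omega⟩
  refine Set.ncard_eq_two.2 ⟨(m + 1) ^ 2 + lam, lam + 1 + (m + 1) * m, by nlinarith, ?_⟩
  ext v
  simp only [Set.mem_ofPred_eq, Set.mem_insert_iff, Set.mem_singleton_iff]
  constructor
  · intro h
    have hvu := le_f (m + 1) v
    have hb2 : Even ((m + 1) ^ 2) := he.pow_of_ne_zero (by norm_num)
    rcases lt_or_ge v ((m + 1) ^ 2) with h1 | h1
    · right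
      obtain ⟨a, c, ha, hc, rfl⟩ := exists_digits_of_lt_sq h1
      rw [f_two_digits hb ha hc] at h
      obtain rfl | rfl | h3 : a = m ∨ m = a + 1 ∨ a + 2 ≤ m := by omega
      · have : c = lam + 1 := by nlinarith
        rw [this]
      · exfalso
        have h4 : Even ((a + 1 + 1) * a) := he.mul_right a
        have h5 : Even a := by
          rw [Nat.even_iff] at he ⊢
          omega
        rw [Nat.even_iff] at hb2 h4 h5
        omega
      · nlinarith
    · left
      rcases lt_or_ge v ((m + 1) ^ 2 + (m + 1)) with h2 | h2
      · obtain ⟨c, rfl⟩ := Nat.exists_eq_add_of_le h1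
        rw [f_sq_add hb (by omega)] at h
        omega
      · obtain ⟨c, rfl⟩ := Nat.exists_eq_add_of_le h2
        rw [f_sq_add_add hb (by omega)] at h
        rw [Nat.even_iff] at hb2 he
        omega
  · rintro (rfl | rfl)
    · exact f_sq_add hb (by omega)
    · rw [f_two_digits hb (by omega) (by omega)]
      ring

theorem f_lt_two_mul {b v : ℕ} (hb : 2 ≤ b) (hv : v < 2 * b) :
    v < b ∧ f b v = 2 * v ∨ b ≤ v ∧ f b v + b = 2 * v + 1 := by
  rcases lt_or_ge v b with h | h
  · left
    refine ⟨h, ?_⟩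
    rw [f, s_of_lt hb h]
    ring
  · right
    obtain ⟨c, rfl⟩ := Nat.exists_eq_add_of_le h
    refine ⟨h, ?_⟩
    have h2 := f_two_digits (a := 1) (c := c) hb (by omega) (by omega)
    rw [mul_one, add_comm c b] at h2
    omega

theorem F_odd {b lam : ℕ} (hb : 3 ≤ b) (ho : Odd b) (hl : lam ≤ (b - 3) / 2) :
    F b (b + 1 + 2 * lam) = 2 := by
  obtain ⟨k, rfl⟩ := ho
  refine Set.ncard_eq_two.2 ⟨k + 1 + lam, 2 * k + 1 + lam, by omega, ?_⟩
  ext v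
  simp only [Set.mem_ofPred_eq, Set.mem_insert_iff, Set.mem_singleton_iff]
  have hvu := le_f (2 * k + 1) v
  rcases lt_or_ge v (2 * (2 * k + 1)) with h | h
  · have := f_lt_two_mul (by omega) h
    omega
  · omega

theorem dvd_sub_of_cast_eq {n r t u : ℕ} (hu : (u : ZMod n) = (r : ZMod n))
    (ht : (t : ZMod n) = (r : ZMod n)) (h : u ≤ t) : n ∣ t - u :=
  (Nat.modEq_iff_dvd' h).1 ((ZMod.natCast_eq_natCast_iff _ _ _).1 (hu.trans ht.symm))

theorem stmt11 (b : ℕ) (hb : 2 ≤ b) :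
    (Even b → ∀ lam : ℕ, lam ≤ b - 2 →
      IsLeast {u : ℕ | F b u = 2 ∧ (u : ZMod (b - 1)) = ((2 + 2 * lam : ℕ) : ZMod (b - 1))}
        (b ^ 2 + 1 + 2 * lam)) ∧
    (Odd b → 3 ≤ b → ∀ lam : ℕ, lam ≤ (b - 3) / 2 →
      IsLeast {u : ℕ | F b u = 2 ∧ (u : ZMod (b - 1)) = ((2 + 2 * lam : ℕ) : ZMod (b - 1))}
        (b + 1 + 2 * lam)) := by
  have hcast : (b : ZMod (b - 1)) = 1 := by
    have h : ((b - 1 + 1 : ℕ) : ZMod (b - 1)) = 1 := by rw [Nat.cast_succ, ZMod.natCast_self, zero_add]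
    rwa [Nat.sub_add_cancel (by omega)] at h
  constructor
  · intro he lam hl
    have hmod : ((b ^ 2 + 1 + 2 * lam : ℕ) : ZMod (b - 1)) = ((2 + 2 * lam : ℕ) : ZMod (b - 1)) := by
      push_cast
      rw [hcast]
      ring
    refine ⟨⟨F_even hb he hl, hmod⟩, ?_⟩
    rintro u ⟨hF, hu⟩
    by_contra! hlt
    obtain ⟨k, hk⟩ := dvd_sub_of_cast_eq hu hmod hlt.le
    obtain ⟨v, w, hne, hv, hw⟩ := exists_ne_of_F_eq_two hF
    have hb2 : Even (b ^ 2) := he.pow_of_ne_zero (by norm_num)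
    have hsmall : u ≤ b ^ 2 ∨ u + b = b ^ 2 + 2 + 2 * lam := by
      by_contra! hcon
      have hk0 : k ≠ 0 := by
        rintro rfl
        omega
      have hk1 : k ≠ 1 := by
        rintro rfl
        omega
      have hk2 : (b - 1) * 2 ≤ (b - 1) * k := Nat.mul_le_mul_left _ (by omega)
      omega
    have key : ∀ x, f b x = u → x < b ^ 2 := by
      intro x hx
      by_contra! hge
      have hxu := le_f b x
      obtain ⟨c, rfl⟩ := Nat.exists_eq_add_of_le hge
      have hc : c < b := by omega
      rw [f_sq_add hb hc] at hx
      rw [Nat.even_iff] at hb2 he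
      omega
    exact hne (f_injOn_of_even hb he (key v hv) (key w hw) (hv.trans hw.symm))
  · intro ho hb3 lam hl
    have hmod : ((b + 1 + 2 * lam : ℕ) : ZMod (b - 1)) = ((2 + 2 * lam : ℕ) : ZMod (b - 1)) := by
      push_cast
      rw [hcast]
      ring
    refine ⟨⟨F_odd hb3 ho hl, hmod⟩, ?_⟩
    rintro u ⟨hF, hu⟩
    by_contra! hlt
    have hle := Nat.le_of_dvd (by omega) (dvd_sub_of_cast_eq hu hmod hlt.le)
    obtain ⟨v, w, hne, hv, hw⟩ := exists_ne_of_F_eq_two hF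
    have hvu := le_f b v
    have hwu := le_f b w
    have h1 := f_lt_two_mul (v := v) hb (by omega)
    have h2 := f_lt_two_mul (v := w) hb (by omega)
    omega

end Kaprekar
end

section
/- Let b = 2. Then for every n ≥ 1 there exists u ∈ ℕ with F(u) = n; and for every n ≥ 2, B(n) = K(⌈n/2⌉) + K(⌊n/2⌋) + 2, K(n) = 2^{B(n)} + 1 + K(⌊n/2⌋), and K(n) > 2·K(n−1). -/
namespace Kaprekar

/-- `K n` is the least `u` with exactly `n` generators. -/
noncomputable def K (b n : ℕ) : ℕ := sInf {u : ℕ | F b u = n}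

/-- `B n = ⌊log_b K(n)⌋`. -/
noncomputable def B (b n : ℕ) : ℕ := Nat.log b (K b n)

theorem s_two_mul (v : ℕ) : s 2 (2 * v) = s 2 v := by
  rcases Nat.eq_zero_or_pos v with rfl | hv
  · simp
  · simp [s, Nat.digits_def' (b := 2) (n := 2 * v) (by norm_num) (by omega)]

theorem s_two_mul_add_one (v : ℕ) : s 2 (2 * v + 1) = s 2 v + 1 := by
  have h1 : (2 * v + 1) % 2 = 1 := by omega
  have h2 : (2 * v + 1) / 2 = v := by omega
  rw [s, Nat.digits_def' (by norm_num) (by omega), List.sum_cons, h1, h2, s, add_comm]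

theorem s_two_pow_add (k w : ℕ) (hw : w < 2 ^ k) : s 2 (2 ^ k + w) = s 2 w + 1 := by
  induction k generalizing w with
  | zero =>
    obtain rfl : w = 0 := by simpa using hw
    simp [s]
  | succ k ih =>
    rw [pow_succ] at hw
    obtain ⟨x, rfl | rfl⟩ := Nat.even_or_odd' w
    · rw [show 2 ^ (k + 1) + 2 * x = 2 * (2 ^ k + x) by ring, s_two_mul, s_two_mul,
        ih x (by omega)]
    · rw [show 2 ^ (k + 1) + (2 * x + 1) = 2 * (2 ^ k + x) + 1 by ring, s_two_mul_add_one,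
        s_two_mul_add_one, ih x (by omega)]

/-- Complementing all `k` binary digits turns a digit sum into its complement to `k`. -/
theorem s_add_s_of_add_eq (k v w : ℕ) (h : v + w + 1 = 2 ^ k) : s 2 v + s 2 w = k := by
  induction k generalizing v w with
  | zero =>
    obtain ⟨rfl, rfl⟩ : v = 0 ∧ w = 0 := by rw [pow_zero] at h; omega
    simp [s]
  | succ k ih =>
    rw [pow_succ] at h
    obtain ⟨x, rfl | rfl⟩ := Nat.even_or_odd' v <;> obtain ⟨y, rfl | rfl⟩ := Nat.even_or_odd' w
    · omega
    · have := ih x y (by omega)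
      rw [s_two_mul, s_two_mul_add_one]
      omega
    · have := ih x y (by omega)
      rw [s_two_mul, s_two_mul_add_one]
      omega
    · omega

theorem f_two_pow_add (k w : ℕ) (hw : w < 2 ^ k) : f 2 (2 ^ k + w) = 2 ^ k + f 2 w + 1 := by
  simp only [f, s_two_pow_add k w hw]
  ring

theorem f_add_f_of_add_eq (k v w : ℕ) (h : v + w + 1 = 2 ^ k) :
    f 2 v + f 2 w + 1 = 2 ^ k + k := by
  have := s_add_s_of_add_eq k v w h
  simp only [f]
  omega

theorem finite_generators (b u : ℕ) : {v : ℕ | f b v = u}.Finite :=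
  (Set.finite_Iic u).subset fun v hv => (le_f b v).trans_eq hv

theorem F_eq_ncard_low_add_ncard_high (u m : ℕ) :
    F 2 u = {v : ℕ | f 2 v = u ∧ v < m}.ncard + {v : ℕ | f 2 v = u ∧ m ≤ v}.ncard := by
  rw [F, ← Set.ncard_inter_add_ncard_sdiff_eq_ncard _ {v : ℕ | v < m} (finite_generators 2 u)]
  congr 2
  ext v
  simp

theorem ncard_high_generators (k a : ℕ) (ha : a + 1 < 2 ^ k) :
    {v : ℕ | f 2 v = 2 ^ k + a + 1 ∧ 2 ^ k ≤ v}.ncard = F 2 a := by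
  rw [F, ← Set.ncard_image_of_injective {v : ℕ | f 2 v = a} (add_right_injective (2 ^ k))]
  congr 1
  ext v
  constructor
  · rintro ⟨hv, hkv⟩
    obtain ⟨w, rfl⟩ := Nat.exists_eq_add_of_le hkv
    have hle := le_f 2 (2 ^ k + w)
    have := f_two_pow_add k w (by omega)
    exact ⟨w, show f 2 w = a by omega, rfl⟩
  · rintro ⟨w, hw, rfl⟩
    have hw : f 2 w = a := hw
    have hle := le_f 2 w
    have := f_two_pow_add k w (by omega)
    exact ⟨show f 2 (2 ^ k + w) = _ by omega, Nat.le_add_right _ _⟩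

theorem ncard_high_generators_two_pow (k : ℕ) :
    {v : ℕ | f 2 v = 2 ^ k ∧ 2 ^ k ≤ v}.ncard = 0 := by
  convert Set.ncard_empty ℕ
  ext v
  simp only [Set.mem_ofPred_eq, Set.mem_empty_iff_false, iff_false]
  rintro ⟨hv, hkv⟩
  obtain ⟨w, rfl⟩ := Nat.exists_eq_add_of_le hkv
  have hle := le_f 2 (2 ^ k + w)
  have := f_two_pow_add k w (by have := Nat.two_pow_pos k; omega)
  omega

theorem ncard_low_generators (k r c : ℕ) (h : r + c + 1 = k) :
    {v : ℕ | f 2 v = 2 ^ k + r ∧ v < 2 ^ k}.ncard = F 2 c := by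
  have hk : k < 2 ^ k := Nat.lt_two_pow_self
  have hlt : ∀ w ∈ {w : ℕ | f 2 w = c}, w < 2 ^ k := fun w hw => by
    have hw : f 2 w = c := hw
    have := le_f 2 w
    omega
  rw [F, ← Set.InjOn.ncard_image (s := {w : ℕ | f 2 w = c}) (f := fun w => 2 ^ k - 1 - w)]
  · congr 1
    ext v
    constructor
    · rintro ⟨hv, hvk⟩
      have := f_add_f_of_add_eq k v (2 ^ k - 1 - v) (by omega)
      exact ⟨2 ^ k - 1 - v, show f 2 _ = c by omega, show 2 ^ k - 1 - (2 ^ k - 1 - v) = v by omega⟩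
    · rintro ⟨w, hw, rfl⟩
      have hwk := hlt w hw
      have hw : f 2 w = c := hw
      have := f_add_f_of_add_eq k (2 ^ k - 1 - w) w (by omega)
      exact ⟨show f 2 (2 ^ k - 1 - w) = _ by omega, show 2 ^ k - 1 - w < 2 ^ k by omega⟩
  · intro w hw x hx hwx
    have := hlt w hw
    have := hlt x hx
    have hwx : 2 ^ k - 1 - w = 2 ^ k - 1 - x := hwx
    omega

theorem ncard_low_generators_of_le (k r : ℕ) (h : k ≤ r) :
    {v : ℕ | f 2 v = 2 ^ k + r ∧ v < 2 ^ k}.ncard = 0 := by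
  convert Set.ncard_empty ℕ
  ext v
  simp only [Set.mem_ofPred_eq, Set.mem_empty_iff_false, iff_false]
  rintro ⟨hv, hvk⟩
  have := f_add_f_of_add_eq k v (2 ^ k - 1 - v) (by omega)
  omega

theorem F_two_pow_add (a c : ℕ) : F 2 (2 ^ (a + c + 2) + 1 + a) = F 2 a + F 2 c := by
  have hk : a + c + 2 < 2 ^ (a + c + 2) := Nat.lt_two_pow_self
  have hhigh := ncard_high_generators (a + c + 2) a (by omega)
  have hlow := ncard_low_generators (a + c + 2) (1 + a) c (by omega)
  rw [add_right_comm] at hhigh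
  rw [← add_assoc] at hlow
  rw [F_eq_ncard_low_add_ncard_high _ (2 ^ (a + c + 2)), hhigh, hlow, add_comm]

theorem F_one : F 2 1 = 0 := by
  rw [F_eq_ncard_low_add_ncard_high 1 (2 ^ 0)]
  have h₁ := ncard_low_generators_of_le 0 0 le_rfl
  have h₂ := ncard_high_generators_two_pow 0
  simp only [pow_zero, add_zero] at h₁ h₂ ⊢
  omega

theorem F_zero : F 2 0 = 1 := by
  have : {v : ℕ | f 2 v = 0} = {0} := by
    ext v
    constructor
    · intro hv
      exact Nat.le_zero.mp ((le_f 2 v).trans_eq hv)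
    · rintro rfl
      simp [f, s]
  rw [F, this, Set.ncard_singleton]

/-- A positive `u` has as many generators as some smaller number, or none at all, or else its
generators split into two families counted by `F 2 a` and `F 2 c`. -/
theorem F_cases (u : ℕ) (hu : 0 < u) :
    F 2 u = 0 ∨ (∃ x < u, F 2 u = F 2 x) ∨ ∃ a c : ℕ, u = 2 ^ (a + c + 2) + 1 + a := by
  set k := Nat.log 2 u
  have hk : 2 ^ k ≤ u := Nat.pow_log_le_self 2 hu.ne'
  have hk' : u < 2 ^ (k + 1) := Nat.lt_pow_succ_log_self (by norm_num) u
  have hlt : k < 2 ^ k := Nat.lt_two_pow_self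
  rw [pow_succ] at hk'
  obtain ⟨r, hr⟩ := Nat.exists_eq_add_of_le hk
  rcases r with _ | a
  · have hhigh := ncard_high_generators_two_pow k
    rcases hk0 : k with _ | j
    · left
      rw [hr, hk0]
      exact F_one
    · right; left
      refine ⟨j, by omega, ?_⟩
      rw [F_eq_ncard_low_add_ncard_high u (2 ^ k), hr,
        ncard_low_generators k 0 j (by omega), add_zero, hhigh, add_zero]
  · rcases le_or_gt k (a + 1) with h | h
    · right; left
      refine ⟨a, by omega, ?_⟩
      rw [F_eq_ncard_low_add_ncard_high u (2 ^ k), hr, ncard_low_generators_of_le k (a + 1) h,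
        zero_add, ← add_assoc, ncard_high_generators k a (by omega)]
    · right; right
      obtain ⟨c, hc⟩ := Nat.exists_eq_add_of_lt h
      refine ⟨a, c, ?_⟩
      rw [hr, show a + c + 2 = k by omega]
      omega

theorem exists_F_eq (n : ℕ) (hn : 1 ≤ n) : ∃ u : ℕ, F 2 u = n := by
  induction n, hn using Nat.le_induction with
  | base => exact ⟨0, F_zero⟩
  | succ n _ ih =>
    obtain ⟨a, ha⟩ := ih
    exact ⟨_, by rw [F_two_pow_add a 0, ha, F_zero]⟩

theorem F_K (n : ℕ) (hn : 1 ≤ n) : F 2 (K 2 n) = n :=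
  Nat.sInf_mem (s := {u : ℕ | F 2 u = n}) (exists_F_eq n hn)

theorem K_le {n u : ℕ} (h : F 2 u = n) : K 2 n ≤ u := Nat.sInf_le h

theorem K_one : K 2 1 = 0 := Nat.le_zero.mp (K_le F_zero)

theorem K_add_le (i j : ℕ) (hi : 1 ≤ i) (hj : 1 ≤ j) :
    K 2 (i + j) ≤ 2 ^ (K 2 i + K 2 j + 2) + 1 + K 2 i :=
  K_le (by rw [F_two_pow_add, F_K i hi, F_K j hj])

theorem exists_K_eq (n : ℕ) (hn : 2 ≤ n) :
    ∃ i j : ℕ, 1 ≤ i ∧ 1 ≤ j ∧ i + j = n ∧ K 2 n = 2 ^ (K 2 i + K 2 j + 2) + 1 + K 2 i := by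
  have hF := F_K n (by omega)
  have hmin : ∀ x < K 2 n, F 2 x ≠ n := fun x hx h => (K_le h).not_gt hx
  have hpos : 0 < K 2 n := by
    rcases Nat.eq_zero_or_pos (K 2 n) with h | h
    · rw [h, F_zero] at hF
      omega
    · exact h
  rcases F_cases (K 2 n) hpos with h | ⟨x, hx, h⟩ | ⟨a, c, h⟩
  · omega
  · exact absurd (h.symm.trans hF) (hmin x hx)
  · have hac : F 2 a + F 2 c = n := by rw [← F_two_pow_add, ← h, hF]
    have hlt : a + c + 2 < 2 ^ (a + c + 2) := Nat.lt_two_pow_self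
    have ha := hmin a (by omega)
    have hc := hmin c (by omega)
    refine ⟨F 2 a, F 2 c, by omega, by omega, hac, ?_⟩
    have hle := K_add_le (F 2 a) (F 2 c) (by omega) (by omega)
    have hKa : K 2 (F 2 a) ≤ a := K_le rfl
    have hKc : K 2 (F 2 c) ≤ c := K_le rfl
    have hpow : 2 ^ (K 2 (F 2 a) + K 2 (F 2 c) + 2) ≤ 2 ^ (a + c + 2) :=
      Nat.pow_le_pow_right (by norm_num) (by omega)
    rw [hac] at hle
    omega

theorem K_eq_of_growth (n : ℕ) (hn : 2 ≤ n)
    (hgrow : ∀ m, 1 ≤ m → m + 1 < n → 2 * K 2 m + 2 ≤ K 2 (m + 1)) :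
    K 2 n = 2 ^ (K 2 ((n + 1) / 2) + K 2 (n / 2) + 2) + 1 + K 2 (n / 2) := by
  have hmono : ∀ i j, 1 ≤ i → i ≤ j → j < n → K 2 i ≤ K 2 j := by
    intro i j hi hij
    induction j, hij using Nat.le_induction with
    | base => exact fun _ => le_rfl
    | succ j hij ih =>
      intro hj
      have := ih (by omega)
      have := hgrow j (by omega) hj
      omega
  have hle := K_add_le (n / 2) ((n + 1) / 2) (by omega) (by omega)
  rw [show n / 2 + (n + 1) / 2 = n by omega, add_comm (K 2 (n / 2)) (K 2 ((n + 1) / 2))] at hle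
  obtain ⟨i, j, hi, hj, hij, hK⟩ := exists_K_eq n hn
  have hfar : ∀ t, (n + 1) / 2 < t → t < n →
      K 2 ((n + 1) / 2) + K 2 (n / 2) < K 2 t := by
    intro t ht htn
    have h₁ := hgrow ((n + 1) / 2) (by omega) (by omega)
    have h₂ := hmono ((n + 1) / 2 + 1) t (by omega) ht htn
    have h₃ := hmono (n / 2) ((n + 1) / 2) (by omega) (by omega) (by omega)
    omega
  have hsum : K 2 i + K 2 j ≤ K 2 ((n + 1) / 2) + K 2 (n / 2) := by
    by_contra! h
    have hlt : K 2 ((n + 1) / 2) + K 2 (n / 2) + 2 <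
      2 ^ (K 2 ((n + 1) / 2) + K 2 (n / 2) + 2) := Nat.lt_two_pow_self
    have hpow : 2 ^ (K 2 ((n + 1) / 2) + K 2 (n / 2) + 2 + 1) ≤ 2 ^ (K 2 i + K 2 j + 2) :=
      Nat.pow_le_pow_right (by norm_num) (by omega)
    rw [pow_succ] at hpow
    omega
  have hi' : i ≤ (n + 1) / 2 := by
    by_contra! h
    have := hfar i h (by omega)
    omega
  have hj' : j ≤ (n + 1) / 2 := by
    by_contra! h
    have := hfar j h (by omega)
    omega
  rcases (by omega : (i = n / 2 ∧ j = (n + 1) / 2) ∨ (i = (n + 1) / 2 ∧ j = n / 2)) with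
    ⟨rfl, rfl⟩ | ⟨rfl, rfl⟩
  · rw [hK, add_comm (K 2 (n / 2))]
  · have := hmono (n / 2) ((n + 1) / 2) (by omega) (by omega) (by omega)
    omega

theorem K_growth (n : ℕ) (hn : 1 ≤ n) : 2 * K 2 n + 2 ≤ K 2 (n + 1) := by
  induction n using Nat.strong_induction_on with
  | _ n ih =>
    have hS := K_eq_of_growth (n + 1) (by omega) fun m hm hmn => ih m (by omega) hm
    rw [show (n + 1 + 1) / 2 = n / 2 + 1 by omega] at hS
    rcases hn.eq_or_lt with rfl | hn
    · have := Nat.lt_two_pow_self (n := K 2 (1 / 2 + 1) + K 2 ((1 + 1) / 2) + 2)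
      rw [K_one]
      omega
    · have hN := K_eq_of_growth n hn fun m hm hmn => ih m (by omega) hm
      have hstep := ih (n / 2) (by omega) (by omega)
      have hlt := Nat.lt_two_pow_self (n := K 2 ((n + 1) / 2) + K 2 (n / 2) + 2)
      have hpow : 2 ^ (K 2 ((n + 1) / 2) + K 2 (n / 2) + 2 + 2) ≤
          2 ^ (K 2 (n / 2 + 1) + K 2 ((n + 1) / 2) + 2) :=
        Nat.pow_le_pow_right (by norm_num) (by omega)
      rw [pow_add _ _ 2] at hpow
      omega

theorem K_eq (n : ℕ) (hn : 2 ≤ n) :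
    K 2 n = 2 ^ (K 2 ((n + 1) / 2) + K 2 (n / 2) + 2) + 1 + K 2 (n / 2) :=
  K_eq_of_growth n hn fun m hm _ => K_growth m hm

theorem B_eq (n : ℕ) (hn : 2 ≤ n) : B 2 n = K 2 ((n + 1) / 2) + K 2 (n / 2) + 2 := by
  have hlt := Nat.lt_two_pow_self (n := K 2 ((n + 1) / 2) + K 2 (n / 2) + 2)
  rw [B, K_eq n hn]
  refine Nat.log_eq_of_pow_le_of_lt_pow (by omega) ?_
  rw [pow_succ _ (K 2 ((n + 1) / 2) + K 2 (n / 2) + 2)]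
  omega

theorem stmt15 :
    (∀ n : ℕ, 1 ≤ n → ∃ u : ℕ, F 2 u = n) ∧
    ∀ n : ℕ, 2 ≤ n →
      B 2 n = K 2 ((n + 1) / 2) + K 2 (n / 2) + 2 ∧
      K 2 n = 2 ^ B 2 n + 1 + K 2 (n / 2) ∧
      2 * K 2 (n - 1) < K 2 n := by
  refine ⟨exists_F_eq, fun n hn => ⟨B_eq n hn, ?_, ?_⟩⟩
  · rw [B_eq n hn]
    exact K_eq n hn
  · have := K_growth (n - 1) (by omega)
    rw [Nat.sub_add_cancel (by omega)] at this
    omega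

end Kaprekar
end
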